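/- arXiv:2410.13569 — 2 statements merged into one kernel-verified Lean document; each statement's English description precedes it below -/
import Mathlib

section
/- Fix natural numbers d_W, d_H, d_Y and set r_U = d_H and r_V = d_Y. Then the set of functions ℝ^{d_W × d_H} → ℝ^{d_Y} expressible as dense experts (i.e., of the form X ↦ (∑_{i,j} W_{i j k} X_{i j})_k for some tensor W ∈ ℝ^{d_W × d_H × d_Y}) is equal to the set of functions expressible as linear probing networks with d_H probes (i.e., of the form X ↦ T(∑_{l=1}^{d_H} E_l(X u_l)) for some probes u_1, …, u_{d_H} ∈ ℝ^{d_H}, linear encoders E_1, …, E_{d_H} : ℝ^{d_W} → ℝ^{d_Y}, and linear head T : ℝ^{d_Y} → ℝ^{d_Y}). (Proposition 1: with linear encoders and a sufficient number of probes, dense experts and linear probing networks have identical expressivity.) -/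
/-- Every linear map on matrices is given by a weight tensor, namely its values on the
matrix units. -/
theorem linearMap_matrix_apply_eq_sum {R m n p : Type*} [CommSemiring R] [Fintype m] [Fintype n]
    [DecidableEq m] [DecidableEq n] (L : Matrix m n R →ₗ[R] (p → R)) (X : Matrix m n R) (k : p) :
    L X k = ∑ i, ∑ j, L (Matrix.single i j 1) k * X i j := by
  conv_lhs => rw [Matrix.matrix_eq_sum_single X]
  simp only [map_sum, Finset.sum_apply]
  refine Finset.sum_congr rfl fun i _ => Finset.sum_congr rfl fun j _ => ?_
  rw [← mul_one (X i j), ← smul_eq_mul, ← Matrix.smul_single, map_smul]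
  simp [mul_comm]


/-- Proposition 1: with linear encoders and `r_U = d_H` probes (and
`r_V = d_Y`), the set of functions `ℝ^{d_W × d_H} → ℝ^{d_Y}` expressible as
dense experts equals the set of functions expressible as linear probing
networks. -/
theorem dense_expert_eq_linear_probing_expressivity (dW dH dY : ℕ) :
    {f : Matrix (Fin dW) (Fin dH) ℝ → (Fin dY → ℝ) |
        ∃ W : Fin dW → Fin dH → Fin dY → ℝ,
          f = fun X => fun k => ∑ i, ∑ j, W i j k * X i j}
      =
    {f : Matrix (Fin dW) (Fin dH) ℝ → (Fin dY → ℝ) |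
        ∃ (u : Fin dH → Fin dH → ℝ)
          (E : Fin dH → ((Fin dW → ℝ) →ₗ[ℝ] (Fin dY → ℝ)))
          (T : (Fin dY → ℝ) →ₗ[ℝ] (Fin dY → ℝ)),
          f = fun X => T (∑ l, E l (X.mulVec (u l)))} := by
  ext f
  constructor
  · rintro ⟨W, rfl⟩
    refine ⟨fun l => Pi.single l 1, fun l => Matrix.mulVecLin (Matrix.of fun k i => W i l k),
      LinearMap.id, ?_⟩
    funext X k
    simp only [LinearMap.id_apply, Finset.sum_apply, Matrix.mulVec_single_one,
      Matrix.mulVecLin_apply]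
    rw [Finset.sum_comm]
    rfl
  · rintro ⟨u, E, T, rfl⟩
    let L : Matrix (Fin dW) (Fin dH) ℝ →ₗ[ℝ] (Fin dY → ℝ) :=
      T ∘ₗ ∑ l, E l ∘ₗ (Matrix.mulVecBilin ℝ ℝ).flip (u l)
    have hL (X : Matrix (Fin dW) (Fin dH) ℝ) : L X = T (∑ l, E l (X.mulVec (u l))) := by
      simp [L]
    refine ⟨fun i j k => L (Matrix.single i j 1) k, ?_⟩
    funext X k
    rw [← hL, linearMap_matrix_apply_eq_sum]
end

section
/- Let d_W, d_H, d_Y, r_U, r_V, r_T be natural numbers, and let M ∈ ℝ^{r_T × r_V × r_U} be a core tensor, U ∈ ℝ^{d_H × r_U}, V ∈ ℝ^{d_W × r_V}, and T ∈ ℝ^{d_Y × r_T} be factor matrices. Define the tensor W ∈ ℝ^{d_W × d_H × d_Y} by the Tucker decomposition W_{i j k} = ∑_{n=1}^{r_T} ∑_{m=1}^{r_V} ∑_{l=1}^{r_U} T_{k n} M_{n m l} V_{i m} U_{j l}. For each l, let M[l] ∈ ℝ^{r_T × r_V} denote the slice (M[l])_{n m} = M_{n m l}, and let u_l ∈ ℝ^{d_H}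 denote the l-th column of U. Then for every matrix X ∈ ℝ^{d_W × d_H}, the vector with coordinates ∑_{i,j} X_{i j} W_{i j k} equals the vector T ∑_{l=1}^{r_U} M[l] V^⊤ X u_l. (Proposition 2: the linear ProbeX architecture computes exactly the dense expert whose weight tensor obeys the Tucker decomposition.) -/
/-- Proposition 2: the linear ProbeX architecture
`X ↦ T ∑_l M[l] Vᵀ X u_l` computes exactly the dense expert whose weight
tensor `W` obeys the Tucker decomposition
`W i j k = ∑ n m l, T k n * M n m l * V i m * U j l`. -/
theorem linear_probex_computes_tucker_dense_expert
    (dW dH dY rU rV rT : ℕ)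
    (M : Fin rT → Fin rV → Fin rU → ℝ)
    (U : Matrix (Fin dH) (Fin rU) ℝ)
    (V : Matrix (Fin dW) (Fin rV) ℝ)
    (T : Matrix (Fin dY) (Fin rT) ℝ)
    (W : Fin dW → Fin dH → Fin dY → ℝ)
    (hW : ∀ i j k, W i j k = ∑ n, ∑ m, ∑ l, T k n * M n m l * V i m * U j l) :
    ∀ X : Matrix (Fin dW) (Fin dH) ℝ,
      (fun k => ∑ i, ∑ j, X i j * W i j k)
        = T.mulVec (∑ l,
            (Matrix.of (fun n m => M n m l)).mulVec
              (V.transpose.mulVec (X.mulVec (fun j => U j l)))) := by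
  intro X
  ext k
  simp only [Matrix.mulVec, dotProduct, Finset.sum_apply, Matrix.of_apply,
    Matrix.transpose_apply, hW, Finset.mul_sum]
  calc ∑ i, ∑ j, ∑ n, ∑ m, ∑ l, X i j * (T k n * M n m l * V i m * U j l)
      = ∑ p : Fin dW × Fin dH, ∑ n, ∑ m, ∑ l,
          X p.1 p.2 * (T k n * M n m l * V p.1 m * U p.2 l) := by
        rw [Fintype.sum_prod_type]
    _ = ∑ n, ∑ m, ∑ l, ∑ p : Fin dW × Fin dH,
          X p.1 p.2 * (T k n * M n m l * V p.1 m * U p.2 l) := by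
        rw [Finset.sum_comm]
        refine Finset.sum_congr rfl fun n _ => ?_
        rw [Finset.sum_comm]
        exact Finset.sum_congr rfl fun m _ => Finset.sum_comm
    _ = ∑ n, ∑ l, ∑ m, ∑ i, ∑ j, T k n * (M n m l * (V i m * (X i j * U j l))) := by
        refine Finset.sum_congr rfl fun n _ => ?_
        rw [Finset.sum_comm]
        refine Finset.sum_congr rfl fun l _ => Finset.sum_congr rfl fun m _ => ?_
        rw [Fintype.sum_prod_type]
        refine Finset.sum_congr rfl fun i _ => Finset.sum_congr rfl fun j _ => ?_
        ring
end
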